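/- Assume q^{2l} = 1 where l ≥ 2 is the smallest positive integer with this property. Write E := C² − λ²C'₂ and Z := (C−λX₀)^l in B, and write Q_l(x) = Σ_j a_j x^j (only terms with l − j even occur). Then in B: X₋^l X₊^l = q^{l(l−1)} λ^{−2l} ( −E^l + q^{−l}·H·Z − Z² ), where H := Σ_{j : l−j even} a_j ((q+q⁻¹)C)^j E^{(l−j)/2}. -/

import Mathlib

noncomputable section

namespace SL2q

/-- The free algebra on the four generators X₀, X₊, X₋, C. -/
abbrev Free := FreeAlgebra ℂ (Fin 4)

def gX0 : Free := FreeAlgebra.ι ℂ 0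
def gXp : Free := FreeAlgebra.ι ℂ 1
def gXm : Free := FreeAlgebra.ι ℂ 2
def gC  : Free := FreeAlgebra.ι ℂ 3

/-- The defining relations of the algebra B of Lyubashenko–Sudbery. -/
inductive Rel (q : ℂ) : Free → Free → Prop
  | r1  : Rel q ((q ^ 2) • (gX0 * gXp) - gXp * gX0) (q • (gC * gXp))
  | r2  : Rel q ((q⁻¹ ^ 2) • (gX0 * gXm) - gXm * gX0) (-(q⁻¹ • (gC * gXm)))
  | r3  : Rel q (gXp * gXm - gXm * gXp)
      ((q + q⁻¹) • ((gC - (q - q⁻¹) • gX0) * gX0))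
  | rc0 : Rel q (gC * gX0) (gX0 * gC)
  | rcp : Rel q (gC * gXp) (gXp * gC)
  | rcm : Rel q (gC * gXm) (gXm * gC)

/-- The algebra B, presented by generators and relations. -/
abbrev B (q : ℂ) := RingQuot (Rel q)

def X0 (q : ℂ) : B q := RingQuot.mkAlgHom ℂ (Rel q) gX0
def Xp (q : ℂ) : B q := RingQuot.mkAlgHom ℂ (Rel q) gXp
def Xm (q : ℂ) : B q := RingQuot.mkAlgHom ℂ (Rel q) gXm
def Cc (q : ℂ) : B q := RingQuot.mkAlgHom ℂ (Rel q) gC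

/-- C'₂ = X₋X₊ + q⁻¹ C X₀ + q⁻² X₀². -/
def C2 (q : ℂ) : B q :=
  Xm q * Xp q + q⁻¹ • (Cc q * X0 q) + (q⁻¹ ^ 2) • (X0 q) ^ 2

theorem exists_add_eq_mul_eq (t e : ℂ) : ∃ a b : ℂ, a + b = t ∧ a * b = e := by
  obtain ⟨s, hs⟩ := IsAlgClosed.exists_eq_mul_self (t ^ 2 - 4 * e)
  exact ⟨(t + s) / 2, (t - s) / 2, by ring, by linear_combination (1 / 4) * hs⟩

theorem coeff_eq_zero_of_odd_sub {Q : Polynomial ℂ} {l : ℕ}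
    (hQ : ∀ x : ℂ, x ≠ 0 → Q.eval (x + x⁻¹) = x ^ l + (x⁻¹) ^ l)
    {j : ℕ} (hj : j ≤ l) (hodd : ¬ Even (l - j)) : Q.coeff j = 0 := by
  have hcomp : Q.comp (Polynomial.C (-1) * Polynomial.X) = Polynomial.C ((-1) ^ l) * Q := by
    refine Polynomial.funext fun t => ?_
    obtain ⟨a, b, rfl, hab⟩ := exists_add_eq_mul_eq t 1
    have ha : a ≠ 0 := left_ne_zero_of_mul_eq_one hab
    obtain rfl : b = a⁻¹ := eq_inv_of_mul_eq_one_right hab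
    have hneg := hQ (-a) (neg_ne_zero.mpr ha)
    rw [inv_neg, neg_pow a, neg_pow a⁻¹, ← neg_add] at hneg
    simp only [Polynomial.eval_comp, Polynomial.eval_X, Polynomial.eval_mul,
      Polynomial.eval_C, neg_one_mul]
    rw [hneg, hQ a ha]
    ring
  have hcoeff := congrArg (fun p => Polynomial.coeff p j) hcomp
  simp only [Polynomial.comp_C_mul_X_coeff, Polynomial.coeff_C_mul] at hcoeff
  obtain ⟨k, rfl⟩ := Nat.exists_eq_add_of_le hj
  rw [Nat.add_sub_cancel_left, Nat.not_even_iff_odd] at hodd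
  rw [pow_add, hodd.neg_one_pow] at hcoeff
  have hunit : ((-1 : ℂ)) ^ j ≠ 0 := by simp
  have : (-1 : ℂ) ^ j * Q.coeff j = 0 := by linear_combination hcoeff / 2
  exact (mul_eq_zero.mp this).resolve_left hunit

theorem sum_coeff_mul_eq_pow_add_pow {Q : Polynomial ℂ} {l : ℕ} (hQdeg : Q.natDegree = l)
    (hQ : ∀ x : ℂ, x ≠ 0 → Q.eval (x + x⁻¹) = x ^ l + (x⁻¹) ^ l)
    {a b : ℂ} (hab : a * b ≠ 0) :
    ∑ j ∈ (Finset.range (l + 1)).filter (fun j => Even (l - j)),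
      Q.coeff j * ((a + b) ^ j * (a * b) ^ ((l - j) / 2)) = a ^ l + b ^ l := by
  obtain ⟨s, hs⟩ := IsAlgClosed.exists_eq_mul_self (a * b)
  have hs0 : s ≠ 0 := by rintro rfl; simp_all
  have ha : a ≠ 0 := left_ne_zero_of_mul hab
  have hbs : b / s = (a / s)⁻¹ := by field_simp; linear_combination hs
  have hQs := hQ (a / s) (div_ne_zero ha hs0)
  rw [← hbs, ← add_div, Polynomial.eval_eq_sum_range, hQdeg] at hQs
  have hsum : s ^ l * ((a / s) ^ l + (b / s) ^ l) = a ^ l + b ^ l := by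
    rw [mul_add, ← mul_pow, ← mul_pow, mul_div_cancel₀ _ hs0, mul_div_cancel₀ _ hs0]
  rw [← hsum, ← hQs, Finset.mul_sum, Finset.sum_filter]
  refine Finset.sum_congr rfl fun j hj => ?_
  have hjl : j ≤ l := Nat.lt_succ_iff.mp (Finset.mem_range.mp hj)
  split_ifs with heven
  · obtain ⟨k, hk⟩ := heven
    obtain rfl : l = j + 2 * k := by lia
    rw [hs, ← sq, ← pow_mul, show 2 * ((j + 2 * k - j) / 2) = 2 * k by lia, pow_add,
      div_pow]
    field_simp
  · rw [coeff_eq_zero_of_odd_sub hQ hjl heven]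
    simp

theorem prod_range_sub_pow_mul {w : ℂ} {l : ℕ} (hw : IsPrimitiveRoot w l) (hl : 0 < l)
    (a y : ℂ) : ∏ k ∈ Finset.range l, (a - w ^ k * y) = a ^ l - y ^ l := by
  rw [hw.pow_sub_pow_eq_prod_sub_mul a y hl, Finset.prod, Finset.prod,
    Polynomial.nthRootsFinset_def, Multiset.toFinset_val,
    Multiset.dedup_eq_self.mpr hw.nthRoots_one_nodup, hw.nthRoots_eq (one_pow l)]
  simp

open scoped IsMulCommutative in
/-- The product over a root-of-unity orbit of a quadratic, in commuting elements of a possibly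
noncommutative algebra. -/
theorem list_prod_quadratic {A : Type*} [Ring A] [Algebra ℂ A] {w : ℂ} {l : ℕ}
    (hw : IsPrimitiveRoot w l) (hl : 0 < l) {Q : Polynomial ℂ} (hQdeg : Q.natDegree = l)
    (hQ : ∀ x : ℂ, x ≠ 0 → Q.eval (x + x⁻¹) = x ^ l + (x⁻¹) ^ l)
    {e t y : A} (het : Commute e t) (hey : Commute e y) (hty : Commute t y) :
    ((List.range l).map fun k => e - w ^ k • (t * y) + (w ^ k) ^ 2 • y ^ 2).prod =
      e ^ l - (∑ j ∈ (Finset.range (l + 1)).filter (fun j => Even (l - j)),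
        Q.coeff j • (t ^ j * e ^ ((l - j) / 2))) * y ^ l + (y ^ l) ^ 2 := by
  have hpoly : ∏ k ∈ Finset.range l, (MvPolynomial.X 0
        - w ^ k • (MvPolynomial.X 1 * MvPolynomial.X 2) + (w ^ k) ^ 2 • MvPolynomial.X 2 ^ 2) =
      (MvPolynomial.X 0 ^ l - (∑ j ∈ (Finset.range (l + 1)).filter (fun j => Even (l - j)),
        Q.coeff j • (MvPolynomial.X 1 ^ j * MvPolynomial.X 0 ^ ((l - j) / 2)))
          * MvPolynomial.X 2 ^ l + (MvPolynomial.X 2 ^ l) ^ 2 : MvPolynomial (Fin 3) ℂ) := by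
    refine MvPolynomial.funext_set (fun _ => {0}ᶜ)
      (fun _ => (Set.finite_singleton 0).infinite_compl) fun x hx => ?_
    have hx0 : x 0 ≠ 0 := hx 0 (Set.mem_univ 0)
    obtain ⟨a, b, ht, he⟩ := exists_add_eq_mul_eq (x 1) (x 0)
    simp only [map_prod, map_add, map_sub, map_mul, map_pow, map_sum, MvPolynomial.smul_eval,
      MvPolynomial.eval_X]
    rw [← ht, ← he, sum_coeff_mul_eq_pow_add_pow hQdeg hQ (he ▸ hx0)]
    trans (∏ k ∈ Finset.range l, (a - w ^ k * x 2)) * ∏ k ∈ Finset.range l, (b - w ^ k * x 2)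
    · rw [← Finset.prod_mul_distrib]
      exact Finset.prod_congr rfl fun k _ => by ring
    · rw [prod_range_sub_pow_mul hw hl, prod_range_sub_pow_mul hw hl]
      ring
  let v : Fin 3 → A := ![e, t, y]
  have hcomm : ∀ a ∈ Set.range v, ∀ b ∈ Set.range v, a * b = b * a := by
    rintro _ ⟨i, rfl⟩ _ ⟨j, rfl⟩
    fin_cases i <;> fin_cases j <;>
      simp [v, het.eq, hey.eq, hty.eq]
  have := Algebra.isMulCommutative_adjoin ℂ hcomm
  let v' : Fin 3 → Algebra.adjoin ℂ (Set.range v) := fun i =>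
    ⟨v i, Algebra.subset_adjoin (Set.mem_range_self i)⟩
  have key := congrArg (fun p => (Algebra.adjoin ℂ (Set.range v)).val (MvPolynomial.aeval v' p)) hpoly
  rw [Finset.prod_eq_multiset_prod, Finset.range_val, ← Multiset.coe_range,
    Multiset.map_coe, Multiset.prod_coe] at key
  simp only [map_list_prod, List.map_map, Function.comp_def, map_add, map_sub, map_mul, map_pow,
    map_sum, map_smul, MvPolynomial.aeval_X, v'] at key
  simpa only [v, Subalgebra.coe_val, Matrix.cons_val] using key


theorem smul_pow_mul_pow_eq_list_prod {A : Type*} [Ring A] [Algebra ℂ A] {r w : ℂ}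
    {e t y p m : A} (hmp : r • (m * p) = e - t * y + y ^ 2) (hyp : y * p = w • (p * y))
    (hpe : Commute p e) (hpt : Commute p t) (n : ℕ) :
    r ^ n • (m ^ n * p ^ n) =
      ((List.range n).map fun k => e - w ^ k • (t * y) + (w ^ k) ^ 2 • y ^ 2).prod := by
  induction n with
  | zero => simp
  | succ n ih =>
    have hy : SemiconjBy (p ^ n) (w ^ n • y) y := by
      have h : ∀ k : ℕ, y * p ^ k = w ^ k • (p ^ k * y) := fun k => by
        induction k with
        | zero => simp
        | succ k ihk =>
          rw [pow_succ, ← mul_assoc, ihk, smul_mul_assoc, mul_assoc, hyp, mul_smul_comm,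
            smul_smul, ← pow_succ, mul_assoc]
      rw [SemiconjBy, mul_smul_comm, h]
    have hsemi : p ^ n * (e - w ^ n • (t * y) + (w ^ n) ^ 2 • y ^ 2) =
        (e - t * y + y ^ 2) * p ^ n := by
      have := (((hpe.pow_left n).semiconjBy.sub_right
        ((hpt.pow_left n).semiconjBy.mul_right hy)).add_right (hy.pow_right 2)).eq
      rwa [mul_smul_comm, smul_pow] at this
    rw [List.range_succ, List.map_append, List.prod_append, List.map_singleton,
      List.prod_singleton, ← ih, smul_mul_assoc, mul_assoc, hsemi, ← hmp, pow_succ m,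
      pow_succ' p, pow_succ r]
    simp only [smul_mul_assoc, mul_smul_comm, smul_smul, mul_assoc]

theorem eq_neg_inv_smul_neg {K M : Type*} [Field K] [AddCommGroup M] [Module K M] {r : K}
    (hr : r ≠ 0) {u v : M} (h : r • u = v) : u = -r⁻¹ • -v := by
  rw [neg_smul_neg, ← h, inv_smul_smul₀ hr]

section Relations

variable (q : ℂ)

theorem commute_Cc_X0 : Commute (Cc q) (X0 q) := by
  have h := RingQuot.mkAlgHom_rel ℂ (Rel.rc0 (q := q))
  rwa [map_mul, map_mul] at h

theorem commute_Cc_Xp : Commute (Cc q) (Xp q) := by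
  have h := RingQuot.mkAlgHom_rel ℂ (Rel.rcp (q := q))
  rwa [map_mul, map_mul] at h

theorem commute_Cc_Xm : Commute (Cc q) (Xm q) := by
  have h := RingQuot.mkAlgHom_rel ℂ (Rel.rcm (q := q))
  rwa [map_mul, map_mul] at h

theorem Xp_mul_X0 : Xp q * X0 q = q ^ 2 • (X0 q * Xp q) - q • (Cc q * Xp q) := by
  have h := RingQuot.mkAlgHom_rel ℂ (Rel.r1 (q := q))
  simp only [map_sub, map_smul, map_mul] at h
  exact (sub_eq_iff_eq_add.mp h) ▸ by rw [X0, Xp, Cc]; abel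

theorem Xm_mul_X0 : Xm q * X0 q = q⁻¹ ^ 2 • (X0 q * Xm q) + q⁻¹ • (Cc q * Xm q) := by
  have h := RingQuot.mkAlgHom_rel ℂ (Rel.r2 (q := q))
  simp only [map_sub, map_smul, map_mul, map_neg] at h
  rw [X0, Xm, Cc, ← sub_eq_iff_eq_add', ← neg_inj, ← h]
  abel

theorem Xp_mul_Xm : Xp q * Xm q =
    Xm q * Xp q + (q + q⁻¹) • ((Cc q - (q - q⁻¹) • X0 q) * X0 q) := by
  have h := RingQuot.mkAlgHom_rel ℂ (Rel.r3 (q := q))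
  simp only [map_sub, map_smul, map_mul] at h
  exact sub_eq_iff_eq_add'.mp h

variable {q}

theorem Xp_mul_sub (hq : q ≠ 0) : Xp q * (Cc q - (q - q⁻¹) • X0 q) =
    q ^ 2 • ((Cc q - (q - q⁻¹) • X0 q) * Xp q) := by
  simp only [mul_sub, sub_mul, mul_smul_comm, smul_mul_assoc, Xp_mul_X0, ← (commute_Cc_Xp q).eq]
  match_scalars <;> field_simp
  ring

theorem smul_Xm_mul_Xp (hq : q ≠ 0) : -((q - q⁻¹) ^ 2) • (Xm q * Xp q) =
    (Cc q ^ 2 - (q - q⁻¹) ^ 2 • C2 q)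
      - ((q + q⁻¹) • Cc q) * (q⁻¹ • (Cc q - (q - q⁻¹) • X0 q))
      + (q⁻¹ • (Cc q - (q - q⁻¹) • X0 q)) ^ 2 := by
  simp only [C2, sq (Cc q), sq (X0 q), sq (q⁻¹ • _), mul_sub, sub_mul, mul_smul_comm,
    smul_mul_assoc, ← (commute_Cc_X0 q).eq]
  match_scalars <;> field_simp <;> ring

theorem commute_Xm_mul_Xp_X0 (hq : q ≠ 0) : Commute (Xm q * Xp q) (X0 q) := by
  rw [Commute, SemiconjBy, mul_assoc, Xp_mul_X0, mul_sub, mul_smul_comm, mul_smul_comm,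
    ← mul_assoc, Xm_mul_X0, add_mul, smul_mul_assoc, smul_mul_assoc, mul_assoc, mul_assoc,
    ← mul_assoc (Xm q) (Cc q), ← (commute_Cc_Xm q).eq, mul_assoc]
  match_scalars <;> field_simp
  ring

theorem commute_E_X0 (hq : q ≠ 0) : Commute (Cc q ^ 2 - (q - q⁻¹) ^ 2 • C2 q) (X0 q) :=
  ((commute_Cc_X0 q).pow_left 2).sub_left <| Commute.smul_left
    (((commute_Xm_mul_Xp_X0 hq).add_left
      (((commute_Cc_X0 q).mul_left (Commute.refl _)).smul_left _)).add_left
        (((Commute.refl _).pow_left 2).smul_left _)) _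

theorem commute_Cc_E : Commute (Cc q) (Cc q ^ 2 - (q - q⁻¹) ^ 2 • C2 q) :=
  ((Commute.refl _).pow_right 2).sub_right <| Commute.smul_right
    ((((commute_Cc_Xm q).mul_right (commute_Cc_Xp q)).add_right
      (((Commute.refl _).mul_right (commute_Cc_X0 q)).smul_right _)).add_right
        (((commute_Cc_X0 q).pow_right 2).smul_right _)) _

theorem commute_Xp_E (hq : q ≠ 0) : Commute (Xp q) (Cc q ^ 2 - (q - q⁻¹) ^ 2 • C2 q) := by
  have hcomm : Xp q * Xm q * Xp q = Xm q * Xp q * Xp q +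
      (q + q⁻¹) • ((Cc q * (X0 q * Xp q)) - (q - q⁻¹) • (X0 q * (X0 q * Xp q))) := by
    rw [Xp_mul_Xm]
    simp only [add_mul, sub_mul, smul_mul_assoc, mul_assoc]
  have hc : ∀ a, Xp q * (Cc q * a) = Cc q * (Xp q * a) := (commute_Cc_Xp q).symm.left_comm
  have hx : ∀ a, X0 q * (Cc q * a) = Cc q * (X0 q * a) := (commute_Cc_X0 q).symm.left_comm
  have hpx : ∀ a, Xp q * (X0 q * a) = q ^ 2 • (X0 q * (Xp q * a)) - q • (Cc q * (Xp q * a)) :=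
    fun a => by rw [← mul_assoc, Xp_mul_X0]; simp only [sub_mul, smul_mul_assoc, mul_assoc]
  rw [Commute, SemiconjBy]
  simp only [mul_assoc] at hcomm
  simp only [C2, sq (Cc q), sq (X0 q), mul_sub, sub_mul, mul_add, add_mul, mul_smul_comm,
    smul_mul_assoc, mul_assoc, hcomm, hc, hx, hpx, Xp_mul_X0, ← (commute_Cc_Xp q).eq]
  match_scalars <;> field_simp <;> ring

end Relations

/-- at a root of unity (l ≥ 2 minimal with q^{2l} = 1), writing
E = C² − λ²C'₂, Z = (C−λX₀)^l, and Q_l(x) = Σ_j a_j x^j the unique polynomial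
with Q_l(x+x⁻¹) = x^l + x^{−l} (only terms with l−j even occur), one has
X₋^l X₊^l = q^{l(l−1)} λ^{−2l} ( −E^l + q^{−l} H Z − Z² ), where
H = Σ_{j : l−j even} a_j ((q+q⁻¹)C)^j E^{(l−j)/2}. -/
theorem XmXp_pow_l (q : ℂ) (hq : q ≠ 0) (hq2 : q ^ 2 ≠ 1)
    (l : ℕ) (hl : 2 ≤ l) (hq2l : q ^ (2 * l) = 1)
    (hmin : ∀ m : ℕ, 0 < m → m < l → q ^ (2 * m) ≠ 1)
    (Q : Polynomial ℂ) (hQdeg : Q.natDegree = l)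
    (hQ : ∀ x : ℂ, x ≠ 0 → Q.eval (x + x⁻¹) = x ^ l + (x⁻¹) ^ l) :
    Xm q ^ l * Xp q ^ l =
      ((q ^ (l * (l - 1)) * ((q - q⁻¹) ^ (2 * l))⁻¹ : ℂ)) •
        ( -((Cc q ^ 2 - ((q - q⁻¹) ^ 2 : ℂ) • C2 q) ^ l)
          + (q⁻¹ ^ l : ℂ) •
            ((∑ j ∈ (Finset.range (l + 1)).filter (fun j => Even (l - j)),
                (Q.coeff j) •
                  ((((q + q⁻¹) : ℂ) • Cc q) ^ j
                    * (Cc q ^ 2 - ((q - q⁻¹) ^ 2 : ℂ) • C2 q) ^ ((l - j) / 2)))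
              * (Cc q - (q - q⁻¹) • X0 q) ^ l)
          - ((Cc q - (q - q⁻¹) • X0 q) ^ l) ^ 2 ) := by
  have hl0 : 0 < l := by lia
  have hw : IsPrimitiveRoot (q⁻¹ ^ 2) l := by
    refine IsPrimitiveRoot.mk_of_lt _ hl0 ?_ fun m hm hml h => hmin m hm hml ?_
    · rw [← pow_mul, inv_pow, hq2l, inv_one]
    · rwa [← pow_mul, inv_pow, inv_eq_one] at h
  have hlam : q - q⁻¹ ≠ 0 := fun h => hq2 <| by
    rw [sq]
    nth_rewrite 2 [sub_eq_zero.mp h]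
    exact mul_inv_cancel₀ hq
  have hEY : Commute (Cc q ^ 2 - (q - q⁻¹) ^ 2 • C2 q) (q⁻¹ • (Cc q - (q - q⁻¹) • X0 q)) :=
    (commute_Cc_E.symm.sub_right ((commute_E_X0 hq).smul_right _)).smul_right _
  have hCY : Commute ((q + q⁻¹) • Cc q) (q⁻¹ • (Cc q - (q - q⁻¹) • X0 q)) :=
    (((Commute.refl _).sub_right ((commute_Cc_X0 q).smul_right _)).smul_right _).smul_left _
  have hYp : q⁻¹ • (Cc q - (q - q⁻¹) • X0 q) * Xp q =
      q⁻¹ ^ 2 • (Xp q * q⁻¹ • (Cc q - (q - q⁻¹) • X0 q)) := by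
    rw [mul_smul_comm, Xp_mul_sub hq, smul_mul_assoc]
    match_scalars
    field_simp
  have hprod := smul_pow_mul_pow_eq_list_prod (smul_Xm_mul_Xp hq) hYp (commute_Xp_E hq)
    ((commute_Cc_Xp q).symm.smul_right _) l
  rw [list_prod_quadratic hw hl0 hQdeg hQ (commute_Cc_E.symm.smul_right _) hEY hCY,
    smul_pow q⁻¹, smul_pow _ _ 2, ← pow_mul q⁻¹, mul_comm l 2, inv_pow q (2 * l), hq2l,
    inv_one, one_smul, mul_smul_comm] at hprod
  have hsign : q ^ (l * (l - 1)) = -(-1) ^ l := by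
    have hql : q ^ l * q ^ l = 1 := by rw [← pow_add, ← two_mul, hq2l]
    rcases mul_self_eq_one_iff.mp hql with h | h
    · rcases Nat.even_or_odd l with ⟨k, hk⟩ | hodd
      · refine absurd ?_ (hmin k (by lia) (by lia))
        rw [two_mul, ← hk, h]
      · rw [pow_mul, h, one_pow, hodd.neg_one_pow, neg_neg]
    · rw [pow_mul, h]
      obtain ⟨k, rfl⟩ := Nat.exists_eq_add_of_lt hl0
      simp [pow_succ]
  have hr : (-(q - q⁻¹) ^ 2) ^ l ≠ 0 := pow_ne_zero _ (neg_ne_zero.mpr (pow_ne_zero _ hlam))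
  have hcoeff : q ^ (l * (l - 1)) * ((q - q⁻¹) ^ (2 * l))⁻¹ = -((-(q - q⁻¹) ^ 2) ^ l)⁻¹ := by
    rw [hsign, neg_pow ((q - q⁻¹) ^ 2), mul_inv, ← inv_pow (-1 : ℂ), inv_neg_one, ← pow_mul,
      neg_mul]
  rw [hcoeff]
  refine (eq_neg_inv_smul_neg hr hprod).trans ?_
  congr 1
  abel

end SL2q
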